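/- Let V be a finite-dimensional real vector space and B a symmetric bilinear form on V satisfying the Hodge index condition. Let d ≥ 1 be a real number and let H, C, C′ ∈ V satisfy: B(H,H) > 4d²; B(C,C) = B(C′,C′) = −2; 0 ≤ B(C,H) ≤ d; 0 ≤ B(C′,H) ≤ d; and B(C,C′) = n for some natural number n. Then n ≤ 2. -/

import Mathlib

/-- A symmetric bilinear form `B` on a real vector space satisfies the Hodge index
condition if every subspace on which `B` is positive definite has dimension at most 1. -/
def HodgeIndexCond {V : Type*} [AddCommGroup V] [Module ℝ V]
    (B : LinearMap.BilinForm ℝ V) : Prop :=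
  ∀ W : Submodule ℝ V, (∀ w ∈ W, w ≠ 0 → 0 < B w w) → Module.finrank ℝ W ≤ 1

/-- The reversed Cauchy–Schwarz inequality for a form satisfying the Hodge index condition. -/
theorem HodgeIndexCond.mul_le_sq {V : Type*} [AddCommGroup V] [Module ℝ V]
    {B : LinearMap.BilinForm ℝ V} (hsym : B.IsSymm) (hB : HodgeIndexCond B) {x y : V}
    (hx : 0 < B x x) : B x x * B y y ≤ B x y ^ 2 := by
  by_contra! hlt
  have hyx : B y x = B x y := hsym.eq y x
  have key : ∀ a b : ℝ, B x x * B (a • x + b • y) (a • x + b • y) =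
      (a * B x x + b * B x y) ^ 2 + b ^ 2 * (B x x * B y y - B x y ^ 2) := by
    intro a b
    simp only [map_add, map_smul, LinearMap.add_apply, LinearMap.smul_apply, smul_eq_mul, hyx]
    ring
  have pos : ∀ a b : ℝ, ¬(a = 0 ∧ b = 0) → 0 < B (a • x + b • y) (a • x + b • y) := by
    intro a b hab
    refine pos_of_mul_pos_right ?_ hx.le
    rw [key]
    by_cases hb : b = 0
    · have ha : a ≠ 0 := fun ha => hab ⟨ha, hb⟩
      subst hb
      have := hx.ne'
      simp only [zero_mul, add_zero, ne_eq, OfNat.ofNat_ne_zero, not_false_eq_true, zero_pow]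
      positivity
    · have := sub_pos.2 hlt
      positivity
  have hli : LinearIndependent ℝ ![x, y] := by
    refine LinearIndependent.pair_iff.2 fun a b h => ?_
    by_contra hab
    simpa [h] using pos a b hab
  have hrank := hB (Submodule.span ℝ (Set.range ![x, y])) fun w hw hw0 => by
    rw [Matrix.range_cons_cons_empty, Submodule.mem_span_pair] at hw
    obtain ⟨a, b, rfl⟩ := hw
    exact pos a b fun ⟨ha, hb⟩ => hw0 (by simp [ha, hb])
  rw [finrank_span_eq_card hli, Fintype.card_fin] at hrank
  omega

theorem stmt_5 {V : Type*} [AddCommGroup V] [Module ℝ V] [FiniteDimensional ℝ V]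
    (B : LinearMap.BilinForm ℝ V) (hsym : B.IsSymm) (hhodge : HodgeIndexCond B)
    (d : ℝ) (hd : 1 ≤ d) (H C C' : V)
    (hH : 4 * d ^ 2 < B H H)
    (hC : B C C = -2) (hC' : B C' C' = -2)
    (hCH : 0 ≤ B C H) (hCH' : B C H ≤ d)
    (hC'H : 0 ≤ B C' H) (hC'H' : B C' H ≤ d)
    (n : ℕ) (hn : B C C' = n) :
    n ≤ 2 := by
  by_contra! hn3
  have hn3' : (3 : ℝ) ≤ n := by exact_mod_cast hn3
  have hC'C : B C' C = n := (hsym.eq C' C).trans hn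
  have hHC : B H C = B C H := hsym.eq H C
  have hHC' : B H C' = B C' H := hsym.eq H C'
  have hH0 : 0 < B H H := by nlinarith
  have hle := hhodge.mul_le_sq hsym (y := C + C') hH0
  simp only [map_add, LinearMap.add_apply, hC, hC', hn, hC'C, hHC, hHC'] at hle
  have hsq : (B C H + B C' H) ^ 2 ≤ (2 * d) ^ 2 := by gcongr; linarith
  nlinarith
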